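/- arXiv:1904.00366 — 2 statements merged into one kernel-verified Lean document; each statement's English description precedes it below -/
import Mathlib

section
/- Let X be a compact metric space and f : X → X a continuous map with the limit shadowing property. Then the restriction f|_{CR(f)} : CR(f) → CR(f) has the shadowing property: for every ε > 0 there is δ > 0 such that every δ-pseudo orbit of f|_{CR(f)} contained in CR(f) is ε-shadowed by a point of CR(f). -/
open Metric Filter Set
open scoped Classical

section Defs

variable {X : Type*} [MetricSpace X]

/-- `(c i)_{i=0}^k` is a δ-chain of `f`. -/
def IsChain' (f : X → X) (δ : ℝ) (c : ℕ → X) (k : ℕ) : Prop :=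
  ∀ i < k, dist (f (c i)) (c (i + 1)) ≤ δ

/-- The chain recurrent set of `f`. -/
def CR (f : X → X) : Set X :=
  {x | ∀ δ > 0, ∃ k > 0, ∃ c : ℕ → X, IsChain' f δ c k ∧ c 0 = x ∧ c k = x}

/-- The chain relation `~` on `CR f`. -/
def ChainRel (f : X → X) (x y : X) : Prop :=
  ∀ δ > 0, ∃ m > 0, ∃ N > 0, ∀ n ≥ N,
    (∃ c : ℕ → X, IsChain' f δ c (m * n) ∧ (∀ i ≤ m * n, c i ∈ CR f) ∧
      c 0 = x ∧ c (m * n) = y) ∧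
    (∃ c : ℕ → X, IsChain' f δ c (m * n) ∧ (∀ i ≤ m * n, c i ∈ CR f) ∧
      c 0 = y ∧ c (m * n) = x)

/-- Property* for a pair `(z, w)`, with cycles lying in `CR f`. -/
def PropertyStar (f : X → X) (z w : X) : Prop :=
  ∃ r > 0, ∀ δ > 0, ∃ k > 0, ∃ c c' : ℕ → X,
    IsChain' f δ c k ∧ IsChain' f δ c' k ∧
    (∀ i ≤ k, c i ∈ CR f) ∧ (∀ i ≤ k, c' i ∈ CR f) ∧
    c 0 = z ∧ c k = z ∧ c' 0 = w ∧ c' k = w ∧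
    ∀ i ≤ k, dist (c i) (c' i) > r

/-- Property* for a pair `(z, w)` (cycles not required to lie in `CR f`). -/
def PropertyStar' (f : X → X) (z w : X) : Prop :=
  ∃ r > 0, ∀ δ > 0, ∃ k > 0, ∃ c c' : ℕ → X,
    IsChain' f δ c k ∧ IsChain' f δ c' k ∧
    c 0 = z ∧ c k = z ∧ c' 0 = w ∧ c' k = w ∧
    ∀ i ≤ k, dist (c i) (c' i) > r

/-- Omega-limit set of the point `(x, y)` under `f × f`. -/
def OmegaLimit2 (f : X → X) (x y : X) : Set (X × X) :=
  {p | ∃ φ : ℕ → ℕ, StrictMono φ ∧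
    Tendsto (fun n => (f^[φ n] x, f^[φ n] y)) atTop (nhds p)}

/-- Omega-limit set of a point under `f`. -/
def OmegaLimit1 (f : X → X) (x : X) : Set X :=
  {p | ∃ φ : ℕ → ℕ, StrictMono φ ∧ Tendsto (fun n => f^[φ n] x) atTop (nhds p)}

/-- `(x, y)` is a DC1-pair for `f`. -/
def DC1Pair (f : X → X) (x y : X) : Prop :=
  (∀ δ > 0, Filter.limsup (fun n : ℕ =>
      (((Finset.range n).filter fun i => dist (f^[i] x) (f^[i] y) < δ).card : ℝ) / n)
      Filter.atTop = 1) ∧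
  (∃ δ₀ > 0, Filter.limsup (fun n : ℕ =>
      (((Finset.range n).filter fun i => dist (f^[i] x) (f^[i] y) > δ₀).card : ℝ) / n)
      Filter.atTop = 1)

/-- `f` exhibits distributional chaos of type 1. -/
def ExhibitsDC1 (f : X → X) : Prop :=
  ∃ S : Set X, ¬ S.Countable ∧ ∀ x ∈ S, ∀ y ∈ S, x ≠ y → DC1Pair f x y

/-- `(x, y)` is a Li-Yorke pair for `f`. -/
def LiYorkePair (f : X → X) (x y : X) : Prop :=
  Filter.liminf (fun n => dist (f^[n] x) (f^[n] y)) Filter.atTop = 0 ∧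
  Filter.limsup (fun n => dist (f^[n] x) (f^[n] y)) Filter.atTop > 0

/-- `(x, y)` is a proximal pair for `f`. -/
def ProximalPair (f : X → X) (x y : X) : Prop :=
  Filter.liminf (fun n => dist (f^[n] x) (f^[n] y)) Filter.atTop = 0

/-- `(x, y)` is a distal pair for `f`. -/
def DistalPair (f : X → X) (x y : X) : Prop :=
  0 < ⨅ n : ℕ, dist (f^[n] x) (f^[n] y)

/-- `f` has the limit shadowing property. -/
def LimitShadowing (f : X → X) : Prop :=
  ∀ x : ℕ → X, Tendsto (fun i => dist (f (x i)) (x (i + 1))) atTop (nhds 0) →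
    ∃ p : X, Tendsto (fun i => dist (f^[i] p) (x i)) atTop (nhds 0)

/-- The restriction of `f` to `CR f` has the shadowing property. -/
def ShadowingOnCR (f : X → X) : Prop :=
  ∀ ε > 0, ∃ δ > 0, ∀ x : ℕ → X, (∀ i, x i ∈ CR f) →
    (∀ i, dist (f (x i)) (x (i + 1)) ≤ δ) →
    ∃ p ∈ CR f, ∀ i, dist (f^[i] p) (x i) ≤ ε

/-- Topological entropy of `f` relative to the cover `U`. -/
noncomputable def entropyOfCover (f : X → X) {ι : Type*} (U : ι → Set X) : ℝ :=
  Filter.limsup (fun n : ℕ =>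
    Real.log ((sInf {m : ℕ | ∃ s : Finset (Fin n → ι), s.card = m ∧
      (⋃ g ∈ s, ⋂ i : Fin n, f^[(i : ℕ)] ⁻¹' U (g i)) = Set.univ} : ℕ) : ℝ) / n)
    Filter.atTop

/-- `(x, y)` is an entropy pair for `f`. -/
def EntropyPair (f : X → X) (x y : X) : Prop :=
  x ≠ y ∧ ∀ A B : Set X, IsClosed A → IsClosed B → x ∈ interior A → y ∈ interior B →
    Disjoint A B → 0 < entropyOfCover f (fun b : Bool => if b then Aᶜ else Bᶜ)

end Defs

/-- one-step relation -/
def stepR {X : Type*} [MetricSpace X] (f : X → X) (η : ℝ) (a b : X) : Prop := dist (f a) b ≤ η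

theorem chain_of_trans {X : Type*} [MetricSpace X] (f : X → X) (η : ℝ) (a b : X)
    (h : Relation.TransGen (stepR f η) a b) :
    ∃ k > 0, ∃ c : ℕ → X, IsChain' f η c k ∧ c 0 = a ∧ c k = b := by
  induction h with
  | single h =>
    rename_i b
    refine ⟨1, one_pos, fun i => if i = 0 then a else b, ?_, by simp, by simp⟩
    intro i hi
    obtain rfl : i = 0 := by omega
    simpa [stepR] using h
  | @tail b d _ h ih =>
    obtain ⟨k, hk, c, hc, h0, hkb⟩ := ih
    refine ⟨k + 1, by omega, fun i => if i ≤ k then c i else d, ?_, by simpa using h0, by simp⟩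
    intro i hi
    by_cases hik : i = k
    · subst hik
      simp only [le_refl, if_true, hkb]
      simpa [stepR] using h
    · have h1 : i ≤ k := by omega
      have h2 : i + 1 ≤ k := by omega
      simp only [h1, h2, if_true]
      exact hc i (by omega)

theorem trans_of_chain {X : Type*} [MetricSpace X] (f : X → X) (η : ℝ) (c : ℕ → X) (k : ℕ)
    (hk : 0 < k) (hc : IsChain' f η c k) : Relation.TransGen (stepR f η) (c 0) (c k) := by
  induction k with
  | zero => omega
  | succ k ih =>
    rcases Nat.eq_zero_or_pos k with rfl | hk'
    · exact Relation.TransGen.single (hc 0 (by omega))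
    · exact Relation.TransGen.tail (ih hk' (fun i hi => hc i (by omega))) (hc k (by omega))

theorem mem_CR_iff {X : Type*} [MetricSpace X] (f : X → X) (x : X) :
    x ∈ CR f ↔ ∀ δ > 0, Relation.TransGen (stepR f δ) x x := by
  constructor
  · intro h δ hδ
    obtain ⟨k, hk, c, hc, h0, h1⟩ := h δ hδ
    have := trans_of_chain f δ c k hk hc
    rwa [h0, h1] at this
  · intro h δ hδ
    exact chain_of_trans f δ x x (h δ hδ)

theorem isClosed_CR {X : Type*} [MetricSpace X] (f : X → X) (hf : Continuous f) :
    IsClosed (CR f) := by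
  rw [← closure_subset_iff_isClosed]
  intro x hx
  rw [mem_CR_iff]
  intro δ hδ
  obtain ⟨γ, hγ, hg⟩ := Metric.continuousAt_iff.1 (hf.continuousAt (x := x)) (δ / 2) (by positivity)
  obtain ⟨x', hx', hd⟩ := Metric.mem_closure_iff.1 hx (min γ (δ / 2)) (by positivity)
  have hd1 := hd.trans_le (min_le_left _ _)
  have hd2 := hd.trans_le (min_le_right _ _)
  have hcyc := (mem_CR_iff f x').1 hx' (δ / 2) (by positivity)
  have hmono : ∀ a b, Relation.ReflTransGen (stepR f (δ / 2)) a b →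
      Relation.ReflTransGen (stepR f δ) a b := fun a b h =>
    Relation.ReflTransGen.mono (fun a b (h : dist (f a) b ≤ δ / 2) => (by unfold stepR; linarith)) _ _ h
  obtain ⟨c1, h1, h2⟩ := Relation.TransGen.head'_iff.1 hcyc
  have h3 : Relation.TransGen (stepR f (δ / 2)) c1 x' := Relation.TransGen.trans_right h2 hcyc
  obtain ⟨d, h4, h5⟩ := Relation.TransGen.tail'_iff.1 h3
  have e1 : stepR f δ x c1 := by
    have a1 := @hg x' (by rwa [dist_comm])
    have a2 : dist (f x') c1 ≤ δ / 2 := h1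
    have := dist_triangle (f x) (f x') c1
    rw [dist_comm (f x) (f x')] at this
    unfold stepR; linarith
  have e2 : stepR f δ d x := by
    have a2 : dist (f d) x' ≤ δ / 2 := h5
    have := dist_triangle (f d) x' x
    rw [dist_comm x' x] at this
    unfold stepR; linarith
  exact Relation.TransGen.head' e1 ((hmono _ _ h4).tail e2)

theorem back_chain {X : Type*} [MetricSpace X] [CompactSpace X] (f : X → X) (hf : Continuous f)
    (η : ℝ) (hη : 0 < η) : ∃ δ > 0, δ ≤ η ∧ ∀ x : ℕ → X, (∀ i, x i ∈ CR f) →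
    (∀ i, dist (f (x i)) (x (i + 1)) ≤ δ) →
    ∀ L, Relation.TransGen (stepR f η) (x L) (x 0) := by
  have huc := CompactSpace.uniformContinuous_of_continuous hf
  obtain ⟨γ, hγ, hg⟩ := Metric.uniformContinuous_iff.1 huc (η / 2) (by positivity)
  refine ⟨min (γ / 3) (η / 2), by positivity, (min_le_right _ _).trans (by linarith), ?_⟩
  intro x hx hp L
  induction L with
  | zero => exact (mem_CR_iff f _).1 (hx 0) η hη
  | succ L ih =>
    refine Relation.TransGen.trans ?_ ih
    have hcyc := (mem_CR_iff f _).1 (hx L) (min (γ / 3) (η / 2)) (by positivity)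
    obtain ⟨c1, h1, h2⟩ := Relation.TransGen.head'_iff.1 hcyc
    have h3 := Relation.TransGen.trans_right h2 hcyc
    obtain ⟨c2, h4, h5⟩ := Relation.TransGen.head'_iff.1 h3
    have hm1 := min_le_left (γ / 3) (η / 2)
    have hm2 := min_le_right (γ / 3) (η / 2)
    refine Relation.TransGen.head' (b := c2) ?_ (Relation.ReflTransGen.mono ?_ _ _ h5)
    · have a1 : dist (f (x L)) c1 ≤ min (γ / 3) (η / 2) := h1
      have a2 : dist (f c1) c2 ≤ min (γ / 3) (η / 2) := h4
      have a3 := hp L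
      have a4 := dist_triangle_left (x (L + 1)) c1 (f (x L))
      have a5 := @hg (x (L + 1)) c1 (by linarith)
      have a6 := dist_triangle (f (x (L + 1))) (f c1) c2
      unfold stepR; linarith
    · intro a b (h : dist (f a) b ≤ _)
      unfold stepR; linarith

theorem compact_shadow {X : Type*} [MetricSpace X] [CompactSpace X] (f : X → X)
    (hf : Continuous f) (K : Set X) (hK : IsClosed K) (ε : ℝ) (y : ℕ → X)
    (h : ∀ L : ℕ, ∃ q ∈ K, ∀ i ≤ L, dist (f^[i] q) (y i) ≤ ε) :
    ∃ q ∈ K, ∀ i, dist (f^[i] q) (y i) ≤ ε := by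
  choose q hqK hq using h
  obtain ⟨p, hp, φ, hφ, ht⟩ := hK.isCompact.tendsto_subseq hqK
  refine ⟨p, hp, fun i => ?_⟩
  have h1 : Tendsto (fun n => dist (f^[i] (q (φ n))) (y i)) atTop (nhds (dist (f^[i] p) (y i))) :=
    (((hf.iterate i).tendsto p).comp ht).dist tendsto_const_nhds
  refine le_of_tendsto h1 ?_
  filter_upwards [eventually_ge_atTop i] with n hn
  exact hq _ i (hn.trans (hφ.id_le n))

theorem orbit_refl {X : Type*} [MetricSpace X] (f : X → X) (δ : ℝ) (hδ : 0 < δ) (p : X) (k : ℕ) :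
    Relation.ReflTransGen (stepR f δ) p (f^[k] p) := by
  induction k with
  | zero => exact Relation.ReflTransGen.refl
  | succ k ih =>
    refine ih.tail ?_
    unfold stepR
    rw [Function.iterate_succ_apply', dist_self]
    exact hδ.le

theorem periodic_shadow {X : Type*} [MetricSpace X] [CompactSpace X] (f : X → X)
    (hf : Continuous f) (ε : ℝ) (y : ℕ → X) (P : ℕ) (hP : 0 < P)
    (hy : ∀ i n, y (i + P * n) = y i) (p : X) (h : ∀ i, dist (f^[i] p) (y i) ≤ ε) :
    ∃ q ∈ CR f, ∀ i, dist (f^[i] q) (y i) ≤ ε := by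
  obtain ⟨q, φ, hφ, ht⟩ := CompactSpace.tendsto_subseq (fun n => f^[P * n] p)
  refine ⟨q, ?_, fun i => ?_⟩
  · rw [mem_CR_iff]
    intro δ hδ
    have h1 := Metric.tendsto_atTop.1 (((hf.tendsto q).comp ht)) δ hδ
    have h2 := Metric.tendsto_atTop.1 ht δ hδ
    obtain ⟨N1, h1⟩ := h1
    obtain ⟨N2, h2⟩ := h2
    have b1 := h1 N1 le_rfl
    have b2 := h2 (N1 + N2 + 2) (by omega)
    have hlt : φ N1 + 2 ≤ φ (N1 + N2 + 2) := by
      have u1 := hφ (show N1 < N1 + 1 by omega)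
      have u2 := hφ (show N1 + 1 < N1 + N2 + 2 by omega)
      omega
    have hlt2 : P * φ N1 + 2 ≤ P * φ (N1 + N2 + 2) := by nlinarith
    obtain ⟨k, hk⟩ := Nat.exists_eq_add_of_le hlt2
    simp only [Function.comp_apply] at b1 b2
    rw [hk] at b2
    have e1 : stepR f δ q (f (f^[P * φ N1] p)) := by
      unfold stepR; rw [dist_comm]; exact b1.le
    have e2 := orbit_refl f δ hδ (f (f^[P * φ N1] p)) k
    refine Relation.TransGen.head' e1 (e2.tail ?_)
    unfold stepR
    have : f (f^[k] (f (f^[P * φ N1] p))) = f^[P * φ N1 + 2 + k] p := by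
      rw [show P * φ N1 + 2 + k = (k + 1) + (P * φ N1 + 1) by omega,
        Function.iterate_add_apply, Function.iterate_succ_apply', Function.iterate_succ_apply']
    rw [this]
    exact b2.le
  · have h1 : Tendsto (fun n => dist (f^[i] (f^[P * φ n] p)) (y i)) atTop
        (nhds (dist (f^[i] q) (y i))) :=
      (((hf.iterate i).tendsto q).comp ht).dist tendsto_const_nhds
    refine le_of_tendsto h1 (Eventually.of_forall fun n => ?_)
    rw [← Function.iterate_add_apply, ← hy i (φ n)]
    exact h _

theorem key_cycle {X : Type*} [MetricSpace X] [CompactSpace X] (f : X → X)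
    (hf : Continuous f) (ε : ℝ)
    (hno : ∀ δ > 0, ∃ x : ℕ → X, (∀ i, x i ∈ CR f) ∧
      (∀ i, dist (f (x i)) (x (i + 1)) ≤ δ) ∧ ∀ p ∈ CR f, ∃ i, ε < dist (f^[i] p) (x i))
    (η : ℝ) (hη : 0 < η) :
    ∃ (y : ℕ → X) (T : ℕ), 0 < T ∧ (∀ i < T, dist (f (y i)) (y (i + 1)) ≤ η) ∧ y T = y 0 ∧
      ∀ q, ∃ i < T, ε < dist (f^[i] q) (y i) := by
  obtain ⟨δ, hδ, hδη, hback⟩ := back_chain f hf η hη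
  obtain ⟨x, hx, hp, hs⟩ := hno δ hδ
  have hL : ∃ L : ℕ, ∀ q ∈ CR f, ∃ i ≤ L, ε < dist (f^[i] q) (x i) := by
    by_contra hc
    push Not at hc
    obtain ⟨q, hq, hq'⟩ := compact_shadow f hf (CR f) (isClosed_CR f hf) ε x hc
    obtain ⟨i, hi⟩ := hs q hq
    exact absurd (hq' i) (not_le.2 hi)
  obtain ⟨L, hL⟩ := hL
  obtain ⟨k, hk, c, hc, hc0, hck⟩ := chain_of_trans f η _ _ (hback x hx hp L)
  set w : ℕ → X := fun i => if i ≤ L then x i else c (i - L) with hw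
  have hw1 : ∀ i ≤ L, w i = x i := fun i hi => by simp [hw, hi]
  have hw2 : ∀ i, w (L + i) = c i := fun i => by
    rcases Nat.eq_zero_or_pos i with rfl | hi
    · simp [hw, hc0]
    · have : ¬ (L + i ≤ L) := by omega
      simp only [hw, this, if_false]
      congr 1
      omega
  have hwst : ∀ i < L + k, dist (f (w i)) (w (i + 1)) ≤ η := by
    intro i hi
    by_cases h1 : i < L
    · rw [hw1 i h1.le, hw1 (i + 1) h1]
      exact (hp i).trans hδη
    · obtain ⟨j, rfl⟩ := Nat.exists_eq_add_of_le (not_lt.1 h1)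
      rw [hw2, add_assoc, hw2]
      exact hc j (by omega)
  have hwP : w (L + k) = w 0 := by rw [hw2, hck, hw1 0 (Nat.zero_le _)]
  set P := L + k with hPdef
  have hP : 0 < P := by omega
  set y : ℕ → X := fun i => w (i % P) with hydef
  have hyper : ∀ i n, y (i + P * n) = y i := fun i n => by simp [hydef]
  have hyst : ∀ i, dist (f (y i)) (y (i + 1)) ≤ η := by
    intro i
    have hlt := Nat.mod_lt i hP
    have : y (i + 1) = w (i % P + 1) := by
      simp only [hydef]
      rw [← Nat.mod_add_mod]
      rcases Nat.lt_or_ge (i % P + 1) P with h1 | h1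
      · rw [Nat.mod_eq_of_lt h1]
      · have : i % P + 1 = P := by omega
        rw [this, Nat.mod_self, hwP]
    rw [this]
    exact hwst _ hlt
  have hyx : ∀ i ≤ L, y i = x i := fun i hi => by
    simp only [hydef]
    rw [Nat.mod_eq_of_lt (by omega), hw1 i hi]
  have hM : ∃ M : ℕ, ∀ q, ∃ i ≤ M, ε < dist (f^[i] q) (y i) := by
    by_contra hcon
    push Not at hcon
    obtain ⟨q, -, hq⟩ := compact_shadow f hf univ isClosed_univ ε y
      (fun L => by obtain ⟨q, hq⟩ := hcon L; exact ⟨q, mem_univ _, hq⟩)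
    obtain ⟨q', hq', hq2⟩ := periodic_shadow f hf ε y P hP hyper q hq
    obtain ⟨i, hi, hlt⟩ := hL q' hq'
    rw [← hyx i hi] at hlt
    exact absurd (hq2 i) (not_le.2 hlt)
  obtain ⟨M, hM⟩ := hM
  refine ⟨y, P * (M + 1), by positivity, fun i _ => hyst i, ?_, fun q => ?_⟩
  · simpa using hyper 0 (M + 1)
  · obtain ⟨i, hi, hlt⟩ := hM q
    exact ⟨i, by nlinarith, hlt⟩

/-- block bookkeeping -/
def stB (T : ℕ → ℕ) : ℕ → ℕ × ℕ
  | 0 => (0, 0)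
  | j + 1 => if (stB T j).2 + 1 < T (stB T j).1 then ((stB T j).1, (stB T j).2 + 1)
      else ((stB T j).1 + 1, 0)

theorem stB_block (T : ℕ → ℕ) (s n : ℕ) (hs : stB T s = (n, 0)) (i : ℕ) (hi : i < T n) :
    stB T (s + i) = (n, i) := by
  induction i with
  | zero => exact hs
  | succ i ih =>
    have := ih (by omega)
    rw [← add_assoc, stB, this]
    simp [hi]

theorem stB_start (T : ℕ → ℕ) (hT : ∀ n, 0 < T n) (n : ℕ) : ∃ s ≥ n, stB T s = (n, 0) := by
  induction n with
  | zero => exact ⟨0, le_rfl, rfl⟩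
  | succ n ih =>
    obtain ⟨s, hsn, hs⟩ := ih
    have h1 := stB_block T s n hs (T n - 1) (by have := hT n; omega)
    refine ⟨s + (T n - 1) + 1, by omega, ?_⟩
    rw [stB, h1]
    have : ¬ (T n - 1 + 1 < T n) := by omega
    simp [this]

theorem stB_mono (T : ℕ → ℕ) : Monotone (fun j => (stB T j).1) := by
  refine monotone_nat_of_le_succ fun j => ?_
  simp only [stB]
  split_ifs <;> simp

theorem stB_lt (T : ℕ → ℕ) (hT : ∀ n, 0 < T n) (j : ℕ) : (stB T j).2 < T (stB T j).1 := by
  induction j with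
  | zero => exact hT 0
  | succ j ih =>
    rw [stB]
    split_ifs with h
    · exact h
    · exact hT _

/-- limit shadowing implies shadowing on the chain recurrent set. -/
theorem limitShadowing_implies_shadowingOnCR {X : Type*} [MetricSpace X] [CompactSpace X]
    (f : X → X) (hf : Continuous f) (h : LimitShadowing f) :
    ShadowingOnCR f := by
  intro ε hε
  by_contra hcon
  push Not at hcon
  have hη : ∀ n : ℕ, (0 : ℝ) < 1 / ((n : ℝ) + 1) := fun n => by positivity
  choose Y S hS hYst hYT hYno using fun n : ℕ => key_cycle f hf ε hcon _ (hη n)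
  obtain ⟨a, φ, hφ, ha⟩ := CompactSpace.tendsto_subseq (fun n => Y n 0)
  set T : ℕ → ℕ := fun n => S (φ n) with hTdef
  set y : ℕ → ℕ → X := fun n => Y (φ n) with hydef
  have hT : ∀ n, 0 < T n := fun n => hS _
  set e : ℕ → ℝ := fun n => 1 / ((φ n : ℝ) + 1) + dist (y n 0) (y (n + 1) 0) with hedef
  have he : Tendsto e atTop (nhds 0) := by
    have h1 : Tendsto (fun n => 1 / ((φ n : ℝ) + 1)) atTop (nhds 0) :=
      (tendsto_one_div_add_atTop_nhds_zero_nat (𝕜 := ℝ)).comp hφ.tendsto_atTop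
    have h2 : Tendsto (fun n => dist (y n 0) (y (n + 1) 0)) atTop (nhds (dist a a)) :=
      Tendsto.dist ha (ha.comp (tendsto_add_atTop_nat 1))
    rw [dist_self] at h2
    simpa [hedef] using h1.add h2
  have hst : Tendsto (fun j => (stB T j).1) atTop atTop := by
    refine tendsto_atTop_atTop_of_monotone (stB_mono T) fun n => ?_
    obtain ⟨s, -, hs⟩ := stB_start T hT n
    exact ⟨s, by rw [hs]⟩
  obtain ⟨p, hp⟩ := h (fun j => y (stB T j).1 (stB T j).2) (by
    refine squeeze_zero (fun _ => dist_nonneg) (fun j => ?_) (he.comp hst)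
    have hlt := stB_lt T hT j
    have h1 := hYst (φ (stB T j).1) (stB T j).2 hlt
    simp only [stB, Function.comp_apply, hedef]
    split_ifs with hc
    · have := dist_nonneg (x := y (stB T j).1 0) (y := y ((stB T j).1 + 1) 0)
      simp only [hydef] at this ⊢
      linarith
    · have hh : (stB T j).2 + 1 = S (φ (stB T j).1) := by
        simp only [hTdef] at hlt hc ⊢
        omega
      rw [hh, hYT] at h1
      have := dist_triangle (f (y (stB T j).1 (stB T j).2)) (y (stB T j).1 0)
        (y ((stB T j).1 + 1) 0)
      simp only [hydef] at this ⊢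
      linarith)
  obtain ⟨N, hN⟩ := Metric.tendsto_atTop.1 hp ε hε
  obtain ⟨s, hsN, hs⟩ := stB_start T hT N
  obtain ⟨i, hi, hlt⟩ := hYno (φ N) (f^[s] p)
  have h1 := hN (s + i) (by omega)
  rw [stB_block T s N hs i hi, Real.dist_0_eq_abs, abs_of_nonneg dist_nonneg, add_comm s i,
    Function.iterate_add_apply] at h1
  exact absurd h1 (not_lt.2 hlt.le)
end

section
/- Let X be a compact metric space and f : X → X a continuous map with the limit shadowing property and h_top(f) > 0. Then f exhibits distributional chaos of type 1: there exists an uncountable set S ⊆ X such that every pair of distinct points of S is a DC1-pair for f. -/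
open Metric Filter Set
open scoped Classical

section Helpers

set_option linter.unusedSectionVars false
set_option linter.unusedVariables false

variable {X : Type*} [MetricSpace X]

/-- Pseudo-orbit segments encoded as lists: `PPath f δ x L y` says that `L` starts at `x` and that
`L` followed by `y` is a `δ`-chain. -/
def PPath (f : X → X) (δ : ℝ) : X → List X → X → Prop
  | x, [], y => x = y
  | x, a :: l, y => a = x ∧ ∃ x', dist (f x) x' ≤ δ ∧ PPath f δ x' l y

lemma PPath.append {f : X → X} {δ : ℝ} {y z : X} {L' : List X} (h' : PPath f δ y L' z) :
    ∀ {x : X} {L : List X}, PPath f δ x L y → PPath f δ x (L ++ L') z := by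
  intro x L
  induction L generalizing x with
  | nil => intro h; simp only [PPath] at h; subst h; simpa using h'
  | cons a l ih =>
    rintro ⟨h1, x', h2, h3⟩
    exact ⟨h1, x', h2, ih h3⟩

lemma PPath.mono {f : X → X} {δ δ' : ℝ} (hd : δ ≤ δ') {y : X} :
    ∀ {x : X} {L : List X}, PPath f δ x L y → PPath f δ' x L y := by
  intro x L
  induction L generalizing x with
  | nil => intro h; exact h
  | cons a l ih =>
    rintro ⟨h1, x', h2, h3⟩
    exact ⟨h1, x', h2.trans hd, ih h3⟩

lemma PPath.change_end {f : X → X} {δ η : ℝ} {y y' : X} (hη : dist y y' ≤ η) :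
    ∀ {x : X} {L : List X}, L ≠ [] → PPath f δ x L y → PPath f (δ + η) x L y' := by
  have h0 : 0 ≤ η := dist_nonneg.trans hη
  intro x L
  induction L generalizing x with
  | nil => intro h; exact absurd rfl h
  | cons a l ih =>
    rintro - ⟨h1, x', h2, h3⟩
    rcases l with _ | ⟨b, l⟩
    · simp only [PPath] at h3
      subst h3
      refine ⟨h1, y', ?_, rfl⟩
      exact (dist_triangle _ _ _).trans (add_le_add h2 hη)
    · exact ⟨h1, x', by linarith, ih (by simp) h3⟩

lemma PPath.getD_zero {f : X → X} {δ : ℝ} {x y : X} {L : List X} (h : PPath f δ x L y) :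
    L.getD 0 y = x := by
  cases L with
  | nil => simp only [PPath] at h; simp [h]
  | cons a l => simpa using h.1

lemma PPath.getD_step {f : X → X} {δ : ℝ} {y : X} :
    ∀ {x : X} {L : List X}, PPath f δ x L y → ∀ j < L.length,
      dist (f (L.getD j y)) (L.getD (j + 1) y) ≤ δ := by
  intro x L
  induction L generalizing x with
  | nil => intro h j hj; simp at hj
  | cons a l ih =>
    rintro ⟨h1, x', h2, h3⟩ j hj
    cases j with
    | zero =>
      have := h3.getD_zero
      simp only [List.getD_cons_zero, List.getD_cons_succ, this, h1]
      exact h2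
    | succ j =>
      simp only [List.getD_cons_succ]
      exact ih h3 j (by simpa using hj)

/-- `n`-fold repetition of a list. -/
def rep (n : ℕ) (L : List X) : List X := (List.replicate n L).flatten

lemma rep_succ (n : ℕ) (L : List X) : rep (n + 1) L = L ++ rep n L := by
  simp [rep, List.replicate_succ]

lemma length_rep (n : ℕ) (L : List X) : (rep n L).length = n * L.length := by
  simp [rep]

lemma PPath.rep {f : X → X} {δ : ℝ} {x : X} {L : List X} (h : PPath f δ x L x) (n : ℕ) :
    PPath f δ x (rep n L) x := by
  induction n with
  | zero => simp [_root_.rep, PPath]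
  | succ n ih => rw [rep_succ]; exact ih.append h

lemma forall2_rep {R : X → X → Prop} {A B : List X} (h : List.Forall₂ R A B) (n : ℕ) :
    List.Forall₂ R (rep n A) (rep n B) := by
  induction n with
  | zero => simp [rep]
  | succ n ih => rw [rep_succ, rep_succ]; exact List.rel_append h ih

/-- Orbit segment as a list. -/
def orb (f : X → X) : X → ℕ → List X
  | _, 0 => []
  | x, n + 1 => x :: orb f (f x) n

lemma length_orb (f : X → X) (x : X) (n : ℕ) : (orb f x n).length = n := by
  induction n generalizing x with
  | zero => rfl
  | succ n ih => simp [orb, ih]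

lemma getD_orb (f : X → X) (x : X) (n j : ℕ) (hj : j < n) (d : X) :
    (orb f x n).getD j d = f^[j] x := by
  induction n generalizing x j with
  | zero => omega
  | succ n ih =>
    cases j with
    | zero => simp [orb]
    | succ j => simp only [orb, List.getD_cons_succ]; rw [ih _ _ (by omega)]; rfl

lemma ppath_orb (f : X → X) (δ : ℝ) (hδ : 0 ≤ δ) (x : X) (n : ℕ) :
    PPath f δ x (orb f x n) (f^[n] x) := by
  induction n generalizing x with
  | zero => rfl
  | succ n ih => exact ⟨rfl, f x, by simpa using hδ, ih (f x)⟩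

lemma ppath_orb' (f : X → X) (δ : ℝ) (x y : X) (n : ℕ) (hn : 0 < n) (h : dist (f^[n] x) y ≤ δ) :
    PPath f δ x (orb f x n) y := by
  have := (ppath_orb f 0 le_rfl x n).change_end h (by
    intro h; have := length_orb f x n; rw [h] at this; simp at this; omega)
  simpa using this

lemma forall2_orb (f : X → X) (R : X → X → Prop) (x y : X) (n : ℕ)
    (h : ∀ j, R (f^[j] x) (f^[j] y)) : List.Forall₂ R (orb f x n) (orb f y n) := by
  induction n generalizing x y with
  | zero => simp [orb]
  | succ n ih => exact List.Forall₂.cons (h 0) (ih _ _ fun j => h (j + 1))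

/-- Infinite concatenation of blocks. -/
lemma exists_concat (B : ℕ → ℕ → X) (len S : ℕ → ℕ) (hlen : ∀ n, 0 < len n) (hS0 : S 0 = 0)
    (hS : ∀ n, S (n + 1) = S n + len n) :
    ∃ g : ℕ → X, ∀ n, ∀ j < len n, g (S n + j) = B n j := by
  have hmono : StrictMono S := strictMono_nat_of_lt_succ fun n => by have := hlen n; rw [hS]; omega
  refine ⟨fun i => B (Nat.findGreatest (fun n => S n ≤ i) i)
    (i - S (Nat.findGreatest (fun n => S n ≤ i) i)), fun n j hj => ?_⟩
  have : Nat.findGreatest (fun m => S m ≤ S n + j) (S n + j) = n := by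
    rw [Nat.findGreatest_eq_iff]
    refine ⟨le_trans (show n ≤ S n from hmono.id_le n) (Nat.le_add_right _ _), fun _ => by omega, fun m hm _ h => ?_⟩
    have h1 : S (n + 1) ≤ S m := hmono.monotone hm
    rw [hS] at h1
    omega
  simp only [this]
  congr 1
  omega

lemma exists_block (S len : ℕ → ℕ) (hlen : ∀ n, 0 < len n) (hS0 : S 0 = 0)
    (hS : ∀ n, S (n + 1) = S n + len n) (N i : ℕ) (hi : S N ≤ i) :
    ∃ n ≥ N, ∃ j < len n, i = S n + j := by
  induction i, hi using Nat.le_induction with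
  | base => exact ⟨N, le_rfl, 0, hlen N, by simp⟩
  | succ i hi ih =>
    obtain ⟨n, hn, j, hj, rfl⟩ := ih
    by_cases h : j + 1 < len n
    · exact ⟨n, hn, j + 1, h, by ring⟩
    · exact ⟨n + 1, by omega, 0, hlen _, by rw [hS]; omega⟩

/-- Limit shadowing applied to a concatenation of finite chains with errors tending to zero. -/
lemma limit_track {f : X → X} (h1 : LimitShadowing f) (x : ℕ → X) (L : ℕ → List X)
    (η : ℕ → ℝ) (hη : Tendsto η atTop (nhds 0)) (hL : ∀ n, 0 < (L n).length)
    (hP : ∀ n, PPath f (η n) (x n) (L n) (x (n + 1)))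
    (S : ℕ → ℕ) (hS0 : S 0 = 0) (hS : ∀ n, S (n + 1) = S n + (L n).length) :
    ∃ p : X, ∀ ε > 0, ∃ N, ∀ n ≥ N, ∀ j < (L n).length, ∀ d,
      dist (f^[S n + j] p) ((L n).getD j d) < ε := by
  have hmono : StrictMono S := strictMono_nat_of_lt_succ fun n => by have := hL n; rw [hS]; omega
  obtain ⟨g, hg⟩ := exists_concat (fun n j => (L n).getD j (x (n + 1))) (fun n => (L n).length)
    S hL hS0 hS
  have herr : ∀ n, ∀ j < (L n).length, dist (f (g (S n + j))) (g (S n + j + 1)) ≤ η n := by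
    intro n j hj
    have key := (hP n).getD_step j hj
    have : g (S n + j + 1) = (L n).getD (j + 1) (x (n + 1)) := by
      by_cases h : j + 1 < (L n).length
      · exact hg n (j + 1) h
      · have e : S n + j + 1 = S (n + 1) + 0 := by rw [hS]; omega
        rw [e, hg (n + 1) 0 (hL _), (hP (n + 1)).getD_zero, List.getD_eq_default _ _ (by omega)]
    rw [this, hg n j hj]
    exact key
  have hg0 : Tendsto (fun i => dist (f (g i)) (g (i + 1))) atTop (nhds 0) := by
    rw [Metric.tendsto_atTop]
    intro ε hε
    obtain ⟨N, hN⟩ := (Metric.tendsto_atTop.1 hη) ε hε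
    refine ⟨S N, fun i hi => ?_⟩
    obtain ⟨n, hn, j, hj, rfl⟩ := exists_block S _ hL hS0 hS N i hi
    have := herr n j hj
    have h2 := hN n hn
    rw [Real.dist_eq, sub_zero] at h2 ⊢
    rw [abs_of_nonneg dist_nonneg]
    exact this.trans_lt ((le_abs_self _).trans_lt h2)
  obtain ⟨p, hp⟩ := h1 g hg0
  refine ⟨p, fun ε hε => ?_⟩
  obtain ⟨N, hN⟩ := (Metric.tendsto_atTop.1 hp) ε hε
  refine ⟨N, fun n hn j hj d => ?_⟩
  have h2 := hN (S n + j) (by have := hmono.id_le n; simp at this; omega)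
  rw [Real.dist_eq, sub_zero, abs_of_nonneg dist_nonneg, hg n j hj] at h2
  rw [List.getD_eq_getElem _ _ hj] at h2 ⊢
  exact h2

/-- Limit shadowing implies that all fine enough cycles are shadowed. -/
lemma cycle_shadow [CompactSpace X] {f : X → X} (h1 : LimitShadowing f) (ε : ℝ) (hε : 0 < ε) :
    ∃ δ > 0, ∀ z L, PPath f δ z L z →
      ∃ y, ∀ j < L.length, ∀ d, dist (f^[j] y) (L.getD j d) ≤ ε := by
  by_contra hcon
  push Not at hcon
  choose z L hP hbad using fun n : ℕ => hcon (1 / ((n : ℝ) + 1)) (by positivity)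
  obtain ⟨a, ψ, hψ, hlim⟩ := CompactSpace.tendsto_subseq z
  have hη : Tendsto (fun n => 1 / ((ψ n : ℝ) + 1) + dist (z (ψ n)) (z (ψ (n + 1)))) atTop
      (nhds 0) := by
    have e1 : Tendsto (fun n => 1 / ((ψ n : ℝ) + 1)) atTop (nhds 0) :=
      (tendsto_one_div_add_atTop_nhds_zero_nat (𝕜 := ℝ)).comp hψ.tendsto_atTop
    have e2 : Tendsto (fun n => dist (z (ψ n)) (z (ψ (n + 1)))) atTop (nhds (dist a a)) :=
      hlim.dist (hlim.comp (tendsto_add_atTop_nat 1))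
    simpa using e1.add e2
  have hL : ∀ n, 0 < (L (ψ n)).length := fun n => by
    obtain ⟨j, hj, -⟩ := hbad (ψ n) a
    omega
  obtain ⟨p, hp⟩ := limit_track h1 (fun n => z (ψ n)) (fun n => L (ψ n)) _ hη hL
    (fun n => (hP (ψ n)).change_end le_rfl (List.ne_nil_of_length_pos (hL n)))
    (fun n => ∑ i ∈ Finset.range n, (L (ψ i)).length) (by simp)
    (fun n => Finset.sum_range_succ _ _)
  obtain ⟨N, hN⟩ := hp ε hε
  obtain ⟨j, hj, d, hd⟩ := hbad (ψ N) (f^[∑ i ∈ Finset.range N, (L (ψ i)).length] p)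
  have := hN N le_rfl j hj d
  rw [add_comm, Function.iterate_add_apply] at this
  linarith

/-- Finite partitions with small cells. -/
lemma exists_cell [CompactSpace X] (η : ℝ) (hη : 0 < η) :
    ∃ (K : ℕ) (cell : X → Fin K), ∀ x y, cell x = cell y → dist x y < η := by
  obtain ⟨t, -, htf, hcov⟩ := finite_cover_balls_of_compact (isCompact_univ (X := X)) (half_pos hη)
  have : ∀ x : X, ∃ c : t, dist x c < η / 2 := fun x => by
    have := hcov (mem_univ x)
    simp only [mem_iUnion, mem_ball] at this
    obtain ⟨c, hc, h⟩ := this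
    exact ⟨⟨c, hc⟩, h⟩
  choose c hc using this
  have : Finite t := htf
  obtain ⟨K, ⟨e⟩⟩ := Finite.exists_equiv_fin t
  refine ⟨K, fun x => e (c x), fun x y h => ?_⟩
  have h' : c x = c y := e.injective h
  have h1 := hc x
  have h2 := hc y
  rw [← h'] at h2
  have := dist_triangle_right x y (c x : X)
  linarith

lemma unif_cont [CompactSpace X] {g : X → X} (hg : Continuous g) (ε : ℝ) (hε : 0 < ε) :
    ∃ δ > 0, ∀ a b, dist a b < δ → dist (g a) (g b) < ε := by
  obtain ⟨δ, h, h'⟩ :=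
    Metric.uniformContinuous_iff.1 (CompactSpace.uniformContinuous_of_continuous hg) ε hε
  exact ⟨δ, h, fun a b hab => h' hab⟩

lemma expGrowthSup_poly (K : ℕ) :
    ExpGrowth.expGrowthSup (fun n : ℕ => (((((n + 1) * (n + 1)) ^ K : ℕ)) : ENNReal)) ≤ 0 := by
  rw [ExpGrowth.expGrowthSup_le_iff]
  intro b hb
  obtain ⟨c, hc0, hcb⟩ := EReal.lt_iff_exists_real_btwn.1 hb
  have hc0' : 0 < c := by exact_mod_cast hc0
  have hreal : ∀ᶠ n : ℕ in atTop, (((n : ℝ) + 1) * (n + 1)) ^ K ≤ Real.exp (c * n) := by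
    have h1 := (isLittleO_pow_exp_pos_mul_atTop (2 * K) hc0').bound
      (show (0 : ℝ) < Real.exp (-c) by positivity)
    have h2 := (tendsto_natCast_atTop_atTop (R := ℝ)).comp (tendsto_add_atTop_nat 1)
    filter_upwards [h2.eventually h1] with n hn
    simp only [Function.comp, Real.norm_eq_abs, Real.abs_exp] at hn
    have h3 := (le_abs_self _).trans hn
    rw [← Real.exp_add] at h3
    push_cast at h3
    calc (((n : ℝ) + 1) * (n + 1)) ^ K = ((n : ℝ) + 1) ^ (2 * K) := by rw [pow_mul, sq]
      _ ≤ _ := h3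
      _ = _ := by congr 1; ring
  filter_upwards [hreal] with n hn
  calc ((((((n + 1) * (n + 1)) ^ K : ℕ)) : ENNReal))
      = ENNReal.ofReal ((((n : ℝ) + 1) * (n + 1)) ^ K) := by
        rw [← ENNReal.ofReal_natCast]; push_cast; rfl
    _ ≤ ENNReal.ofReal (Real.exp (c * n)) := ENNReal.ofReal_le_ofReal hn
    _ = EReal.exp ((c : EReal) * n) := by
        rw [← EReal.exp_coe]; push_cast; rfl
    _ ≤ EReal.exp (b * n) := by
        apply EReal.exp_monotone
        exact mul_le_mul_of_nonneg_right hcb.le (by positivity)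

/-- If a finite code determines orbits of length `n` up to `U`, then small covers exist. -/
lemma coverMincard_le_of_code (f : X → X) (U : SetRel X X) (n : ℕ) {α : Type*} [Fintype α]
    (code : X → α)
    (h : ∀ x y, code x = code y → ∀ i < n, (f^[i] x, f^[i] y) ∈ U) :
    Dynamics.coverMincard f univ U n ≤ (Fintype.card α : ℕ∞) := by
  by_cases hX : Nonempty X
  · have hinv : ∀ x, code (Function.invFun code (code x)) = code x := fun x =>
      Function.invFun_eq ⟨x, rfl⟩
    have hs : Dynamics.IsDynCoverOf f univ U n
        ((Finset.univ.image (Function.invFun code) : Finset X) : Set X) := by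
      intro x _
      refine ⟨Function.invFun code (code x), by simp, ?_⟩
      simp only [Dynamics.dynEntourage, mem_iInter, mem_preimage]
      intro i hi
      have := h x _ (hinv x).symm i hi
      rwa [Prod.map_iterate]
    exact hs.coverMincard_le_card.trans (by exact_mod_cast Finset.card_image_le)
  · have : (univ : Set X) = ∅ := by
      rw [univ_eq_empty_iff]; exact not_nonempty_iff.1 hX
    rw [this, Dynamics.coverMincard_empty]
    exact zero_le

/-- Positive entropy yields, at a fixed scale, pairs of separated `δ`-cycles through the same
point with the same length. -/
lemma exists_cycles [CompactSpace X] {f : X → X} (hf : Continuous f)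
    (h2 : 0 < Dynamics.coverEntropy f Set.univ) :
    ∃ ε > 0, ∀ δ > 0, ∃ z, ∃ C C' : List X, PPath f δ z C z ∧ PPath f δ z C' z ∧
      C.length = C'.length ∧ ∃ i < C.length, ε < dist (C.getD i z) (C'.getD i z) := by
  by_contra hcon
  push Not at hcon
  refine absurd h2 (not_lt.2 ?_)
  unfold Dynamics.coverEntropy
  refine iSup₂_le fun U hU => ?_
  obtain ⟨ε', hε', hUε⟩ := Metric.mem_uniformity_dist.1 hU
  obtain ⟨δ, hδ, hno⟩ := hcon (ε' / 2) (half_pos hε')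
  obtain ⟨δ₁, hδ₁, hun⟩ := unif_cont hf δ hδ
  obtain ⟨K, cell, hcell⟩ := exists_cell (X := X) (min (min δ δ₁) (ε' / 2)) (by positivity)
  refine le_trans ?_ (expGrowthSup_poly K)
  refine ExpGrowth.expGrowthSup_monotone fun n => ?_
  let fst : X → Fin K → ℕ := fun x u => sInf {i | i = n ∨ (i < n ∧ cell (f^[i] x) = u)}
  let lst : X → Fin K → ℕ := fun x u =>
    ((Finset.range n).filter fun i => cell (f^[i] x) = u).sup id
  have hfst : ∀ x u, fst x u < n + 1 := fun x u =>
    Nat.lt_succ_of_le (Nat.sInf_le (Or.inl rfl))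
  have hlst : ∀ x u, lst x u < n + 1 := fun x u => by
    refine Nat.lt_succ_of_le (Finset.sup_le fun i hi => ?_)
    simp only [Finset.mem_filter, Finset.mem_range] at hi
    exact hi.1.le
  let code : X → Fin K → Fin (n + 1) × Fin (n + 1) := fun x u =>
    (⟨fst x u, hfst x u⟩, ⟨lst x u, hlst x u⟩)
  have hfst_mem : ∀ x u, fst x u < n → cell (f^[fst x u] x) = u := fun x u hlt => by
    have := Nat.sInf_mem (s := {i | i = n ∨ (i < n ∧ cell (f^[i] x) = u)}) ⟨n, Or.inl rfl⟩
    rcases this with h | h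
    · exact absurd h hlt.ne
    · exact h.2
  have hlst_mem : ∀ x u i, i < n → cell (f^[i] x) = u → cell (f^[lst x u] x) = u := by
    intro x u i hi hc
    have hne : ((Finset.range n).filter fun i => cell (f^[i] x) = u).Nonempty :=
      ⟨i, by simp [hi, hc]⟩
    obtain ⟨k, hk, hk'⟩ := Finset.exists_mem_eq_sup _ hne id
    simp only [Finset.mem_filter, Finset.mem_range] at hk
    change ((Finset.range n).filter fun i => cell (f^[i] x) = u).sup id = k at hk'
    change cell (f^[((Finset.range n).filter fun i => cell (f^[i] x) = u).sup id] x) = u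
    rw [hk']
    exact hk.2
  have key : ∀ x y, code x = code y → ∀ i < n, (f^[i] x, f^[i] y) ∈ U := by
    intro x y hxy i hi
    apply hUε
    obtain ⟨u, hu⟩ : ∃ u, cell (f^[i] x) = u := ⟨_, rfl⟩
    have e1 : fst x u = fst y u := congrArg (fun c => ((c u).1 : ℕ)) hxy
    have e2 : lst x u = lst y u := congrArg (fun c => ((c u).2 : ℕ)) hxy
    have hai : fst x u ≤ i := Nat.sInf_le (Or.inr ⟨hi, hu⟩)
    have hib : i ≤ lst x u :=
      Finset.le_sup (f := id) (show i ∈ (Finset.range n).filter fun i => cell (f^[i] x) = u by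
        simp [hi, hu])
    have hxa := hfst_mem x u (by omega)
    have hya := hfst_mem y u (by omega)
    have hxb := hlst_mem x u _ (by omega) hxa
    have hyb := hlst_mem y u _ (by omega) hya
    rw [← e1] at hya
    rw [← e2] at hyb
    generalize fst x u = a at *
    generalize lst x u = b at *
    have close : ∀ p q, cell p = u → cell q = u → dist p q < δ ∧ dist p q < δ₁ ∧
        dist p q < ε' / 2 := by
      intro p q hp hq
      have := hcell p q (hp.trans hq.symm)
      simp only [lt_min_iff] at this
      tauto
    by_cases hia : i = a
    · subst hia
      have := (close _ _ hxa hya).2.2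
      linarith
    by_cases hib' : i = b
    · subst hib'
      have := (close _ _ hxb hyb).2.2
      linarith
    have hC : PPath f δ (f^[a] x) (orb f (f^[a] x) (b - a)) (f^[a] x) := by
      apply ppath_orb' _ _ _ _ _ (by omega)
      rw [← Function.iterate_add_apply, show b - a + a = b by omega]
      exact (close _ _ hxb hxa).1.le
    have hC' : PPath f δ (f^[a] x) (f^[a] x :: orb f (f^[a + 1] y) (b - a - 1)) (f^[a] x) := by
      refine ⟨rfl, f^[a + 1] y, ?_, ?_⟩
      · rw [Function.iterate_succ_apply']
        exact (hun _ _ (close _ _ hxa hya).2.1).le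
      · apply ppath_orb' _ _ _ _ _ (by omega)
        rw [← Function.iterate_add_apply, show b - a - 1 + (a + 1) = b by omega]
        exact (close _ _ hyb hxa).1.le
    have := hno _ _ _ hC hC' (by simp [length_orb]; omega) (i - a) (by rw [length_orb]; omega)
    rw [getD_orb _ _ _ _ (by omega), show i - a = (i - a - 1) + 1 by omega,
      List.getD_cons_succ, getD_orb _ _ _ _ (by omega), ← Function.iterate_add_apply,
      ← Function.iterate_add_apply, show i - a - 1 + 1 + a = i by omega,
      show i - a - 1 + (a + 1) = i by omega] at this
    linarith
  have h3 := coverMincard_le_of_code f U n code key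
  have hcard : Fintype.card (Fin K → Fin (n + 1) × Fin (n + 1)) = ((n + 1) * (n + 1)) ^ K := by
    simp
  rw [hcard] at h3
  refine (ENat.toENNReal_le.2 h3).trans_eq ?_
  simp

/-- Horseshoe: every 0-1 sequence is realized along a power of `f`. -/
lemma exists_horseshoe [CompactSpace X] {f : X → X} (hf : Continuous f) (h1 : LimitShadowing f)
    (h2 : 0 < Dynamics.coverEntropy f Set.univ) :
    ∃ ε > 0, ∃ l > 0, ∃ u : Bool → X, (∀ a b, a ≠ b → 3 * ε < dist (u a) (u b)) ∧
      ∀ s : ℕ → Bool, ∃ y, ∀ i, dist (f^[l * i] y) (u (s i)) ≤ ε := by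
  obtain ⟨ε₀, hε₀, hcyc⟩ := exists_cycles hf h2
  obtain ⟨δ, hδ, hsh⟩ := cycle_shadow h1 (ε₀ / 3) (by positivity)
  obtain ⟨z, C, C', hC, hC', hlen, i₀, hi₀, hsep⟩ := hcyc δ hδ
  let D : Bool → List X := fun b => if b then C' else C
  have hD : ∀ b, PPath f δ z (D b) z := fun b => by cases b <;> simp [D, hC, hC']
  have hDl : ∀ b, (D b).length = C.length := fun b => by cases b <;> simp [D, hlen]
  refine ⟨ε₀ / 3, by positivity, C.length, by omega, fun b => (D b).getD i₀ z, ?_, ?_⟩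
  · intro a b hab
    cases a <;> cases b <;> simp only [ne_eq, not_true_eq_false] at hab
    · rw [mul_div_cancel₀ _ (three_ne_zero)]; simpa [D] using hsep
    · rw [dist_comm, mul_div_cancel₀ _ (three_ne_zero)]; simpa [D] using hsep
  · intro s
    let W : ℕ → List X := fun N => Nat.rec [] (fun n w => w ++ D (s n)) N
    have hWs : ∀ n, W (n + 1) = W n ++ D (s n) := fun n => rfl
    have hWl : ∀ n, (W n).length = C.length * n := by
      intro n
      induction n with
      | zero => rfl
      | succ n ih => rw [hWs, List.length_append, ih, hDl]; ring
    have hWp : ∀ n, PPath f δ z (W n) z := by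
      intro n
      induction n with
      | zero => rfl
      | succ n ih => rw [hWs]; exact (hD _).append ih
    have hWg : ∀ n, ∀ i < n, (W n).getD (C.length * i + i₀) z = (D (s i)).getD i₀ z := by
      intro n
      induction n with
      | zero => intro i hi; omega
      | succ n ih =>
        intro i hi
        rw [hWs]
        rcases Nat.lt_succ_iff_lt_or_eq.1 hi with h | h
        · rw [List.getD_append, ih i h]
          rw [hWl]
          have : C.length * (i + 1) ≤ C.length * n := Nat.mul_le_mul_left _ h
          rw [mul_add] at this
          omega
        · subst h
          rw [List.getD_append_right _ _ _ _ (by rw [hWl]; omega), hWl]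
          congr 1
          omega
    obtain ⟨y, hy⟩ := IsCompact.nonempty_iInter_of_sequence_nonempty_isCompact_isClosed
      (fun n => {y | ∀ i < n, dist (f^[C.length * i] y) ((D (s i)).getD i₀ z) ≤ ε₀ / 3})
      (fun n y hy i hi => hy i (by omega))
      (fun n => by
        obtain ⟨y, hy⟩ := hsh z (W n) (hWp n)
        refine ⟨f^[i₀] y, fun i hi => ?_⟩
        rw [← Function.iterate_add_apply, ← hWg n i hi]
        apply hy
        rw [hWl]
        have : C.length * (i + 1) ≤ C.length * n := Nat.mul_le_mul_left _ hi
        rw [mul_add] at this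
        omega)
      (by simpa using isCompact_univ)
      (fun n => by
        simp only [ofPred_forall]
        refine isClosed_iInter fun i => isClosed_iInter fun _ => ?_
        exact isClosed_le ((hf.iterate _).dist continuous_const) continuous_const)
    refine ⟨y, fun i => ?_⟩
    exact (mem_iInter.1 hy (i + 1)) i (by omega)

lemma forall2_getD {R : X → X → Prop} {A B : List X} (h : List.Forall₂ R A B) (d : X) :
    ∀ j < A.length, R (A.getD j d) (B.getD j d) := by
  induction h with
  | nil => intro j hj; simp at hj
  | cons hab _ ih =>
    intro j hj
    cases j with
    | zero => simpa using hab
    | succ j =>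
      simp only [List.getD_cons_succ]
      exact ih j (by simpa using hj)

/-- The symbol sequence of period `2q+1` that differs from its shift by `q` except at one place
of each period. -/
def sym (q i : ℕ) : Bool := decide (i % (2 * q + 1) < q)

lemma sym_period (q i j : ℕ) : sym q (i + (2 * q + 1) * j) = sym q i := by
  simp [sym, Nat.add_mul_mod_self_left]

lemma sym_ne (q i : ℕ) (h : i % (2 * q + 1) ≠ q) : sym q i ≠ sym q (i + q) := by
  have hlt : i % (2 * q + 1) < 2 * q + 1 := Nat.mod_lt _ (by omega)
  have e : (i + q) % (2 * q + 1) = (i % (2 * q + 1) + q) % (2 * q + 1) := by simp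
  simp only [sym, e]
  generalize i % (2 * q + 1) = m at *
  rcases lt_or_ge m q with h1 | h1
  · rw [Nat.mod_eq_of_lt (by omega)]
    simp [h1]
  · have h2 : m + q = (m - q - 1) + (2 * q + 1) := by omega
    rw [h2, Nat.add_mod_right, Nat.mod_eq_of_lt (by omega)]
    simp; omega

lemma sym_ne' (q i : ℕ) (hq : 0 < q) : sym q i ≠ sym q (i + q) ∨
    sym q (i + 1) ≠ sym q (i + 1 + q) := by
  by_cases h : i % (2 * q + 1) = q
  · right
    apply sym_ne
    rw [Nat.add_mod, h, Nat.mod_eq_of_lt (show 1 < 2 * q + 1 by omega),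
      Nat.mod_eq_of_lt (by omega)]
    omega
  · left; exact sym_ne q i h

lemma unif_cont_le [CompactSpace X] {f : X → X} (hf : Continuous f) (ε : ℝ) (hε : 0 < ε) (m : ℕ) :
    ∃ δ > 0, ∀ a b, dist a b < δ → ∀ k ≤ m, dist (f^[k] a) (f^[k] b) < ε := by
  induction m with
  | zero => 
    refine ⟨ε, hε, fun a b h k hk => ?_⟩
    obtain rfl : k = 0 := by omega
    simpa using h
  | succ m ih =>
    obtain ⟨δ, hδ, h⟩ := ih
    obtain ⟨δ', hδ', h'⟩ := unif_cont (hf.iterate (m + 1)) ε hε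
    refine ⟨min δ δ', by positivity, fun a b hab k hk => ?_⟩
    rcases Nat.le_succ_iff.1 hk with h3 | h3
    · exact h a b (hab.trans_le (min_le_left _ _)) k h3
    · subst h3; exact h' a b (hab.trans_le (min_le_right _ _))

lemma exists_good [CompactSpace X] {f : X → X} (hf : Continuous f) (h1 : LimitShadowing f)
    (h2 : 0 < Dynamics.coverEntropy f Set.univ) :
    ∃ r > 0, ∀ δ > 0, ∃ z : X, ∃ t : ℕ, ∀ M : ℕ, ∃ U V : List X,
      PPath f δ z U z ∧ PPath f δ z V z ∧ V.length = U.length ∧ M < U.length ∧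
      ∀ i, t ≤ i → i < M → r ≤ dist (U.getD i z) (V.getD i z) := by
  obtain ⟨ε, hε, l, hl, u, hu, hshoe⟩ := exists_horseshoe hf h1 h2
  obtain ⟨r, hr, hrl⟩ := unif_cont_le hf ε hε (2 * l)
  refine ⟨r, hr, fun δ hδ => ?_⟩
  obtain ⟨K, cell, hcell⟩ := exists_cell (X := X) δ hδ
  have hK : 0 < K := Fin.pos (cell (u true))
  obtain ⟨q, hqdef⟩ : ∃ q, q = K.factorial := ⟨_, rfl⟩
  have hKq : K ≤ q := hqdef ▸ Nat.self_le_factorial K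
  have hq : 0 < q := by omega
  obtain ⟨P, hP⟩ : ∃ P, P = 2 * q + 1 := ⟨_, rfl⟩
  obtain ⟨y, hy⟩ := hshoe (sym q)
  obtain ⟨η, hη, hηf⟩ := unif_cont_le hf δ hδ (l * q)
  obtain ⟨K₂, cell₂, hcell₂⟩ := exists_cell (X := X) η hη
  -- an almost periodic point
  obtain ⟨j₁, j₂, hj, hjc⟩ : ∃ j₁ j₂ : ℕ, j₁ < j₂ ∧
      cell₂ (f^[l * (P * j₁)] y) = cell₂ (f^[l * (P * j₂)] y) := by
    obtain ⟨a, b, hab, h⟩ :=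
      Finite.exists_ne_map_eq_of_infinite fun j : ℕ => cell₂ (f^[l * (P * j)] y)
    rcases lt_or_gt_of_ne hab with h' | h'
    · exact ⟨a, b, h', h⟩
    · exact ⟨b, a, h', h.symm⟩
  obtain ⟨z, hz⟩ : ∃ z, z = f^[l * (P * j₁)] y := ⟨_, rfl⟩
  obtain ⟨w, hw⟩ : ∃ w, w = f^[l * q] z := ⟨_, rfl⟩
  obtain ⟨j, hjd⟩ : ∃ j, j₂ = j₁ + 1 + j := ⟨j₂ - j₁ - 1, by omega⟩
  obtain ⟨R, hR⟩ : ∃ R, R = l * (P * (j + 1)) := ⟨_, rfl⟩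
  have hRz : dist (f^[R] z) z < η := by
    rw [dist_comm]
    apply hcell₂
    rw [hz, ← Function.iterate_add_apply, hjc, hR, hjd]
    congr 2
    ring
  have hRbig : l * P ≤ R := by
    rw [hR]
    exact Nat.mul_le_mul_left _ (Nat.le_mul_of_pos_right _ (by omega))
  have hlP : l * P = l * q + l * q + l := by rw [hP]; ring
  have hlq : q ≤ l * q := Nat.le_mul_of_pos_left _ hl
  have hzs : ∀ i, dist (f^[l * i] z) (u (sym q i)) ≤ ε := fun i => by
    have := hy (i + P * j₁)
    rw [hP, sym_period, ← hP] at this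
    rwa [hz, ← Function.iterate_add_apply, ← mul_add]
  have hws : ∀ i, dist (f^[l * i] w) (u (sym q (i + q))) ≤ ε := fun i => by
    have := hzs (i + q)
    rwa [hw, ← Function.iterate_add_apply, ← mul_add]
  have hsepi : ∀ i, sym q i ≠ sym q (i + q) → ε ≤ dist (f^[l * i] z) (f^[l * i] w) := by
    intro i hi
    have h3 := hu _ _ hi
    have h4 := hzs i
    have h5 := hws i
    have h6 := dist_triangle4 (u (sym q i)) (f^[l * i] z) (f^[l * i] w) (u (sym q (i + q)))
    rw [dist_comm (u (sym q i)) (f^[l * i] z)] at h6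
    linarith
  have hsep : ∀ m, r ≤ dist (f^[m] z) (f^[m] w) := by
    intro m
    by_contra hlt
    push Not at hlt
    have h3 := hrl _ _ hlt
    have hd : l * (m / l) + m % l = m := Nat.div_add_mod m l
    have hm : m % l < l := Nat.mod_lt _ hl
    have step : ∀ i, m ≤ l * i → l * i ≤ m + 2 * l →
        dist (f^[l * i] z) (f^[l * i] w) < ε := by
      intro i hi hi'
      have := h3 (l * i - m) (by omega)
      rwa [← Function.iterate_add_apply, ← Function.iterate_add_apply,
        show l * i - m + m = l * i by omega] at this
    have e1 : l * (m / l + 1) = l * (m / l) + l := by ring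
    have e2 : l * (m / l + 1 + 1) = l * (m / l) + l + l := by ring
    rcases sym_ne' q (m / l + 1) hq with h | h
    · exact absurd (step _ (by omega) (by omega)) (not_lt.2 (hsepi _ h))
    · exact absurd (step _ (by omega) (by omega)) (not_lt.2 (hsepi _ h))
  -- the short cycle
  obtain ⟨a, b, hab, hbK, hcab⟩ : ∃ a b : ℕ, a < b ∧ b ≤ K ∧
      cell (f^[a + 1] z) = cell (f^[b + 1] z) := by
    obtain ⟨a, b, hab, h⟩ := Fintype.exists_ne_map_eq_of_card_lt
      (fun j : Fin (K + 1) => cell (f^[(j : ℕ) + 1] z)) (by simp)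
    have hab' : (a : ℕ) ≠ b := fun h => hab (Fin.ext h)
    rcases lt_or_gt_of_ne hab' with h' | h'
    · exact ⟨a, b, h', by omega, h⟩
    · exact ⟨b, a, h', by omega, h.symm⟩
  obtain ⟨e, he⟩ : ∃ e, b = a + e := ⟨b - a, by omega⟩
  have hedvd : e ∣ l * q := by
    apply Dvd.dvd.mul_left
    rw [hqdef]
    exact Nat.dvd_factorial (by omega) (by omega)
  obtain ⟨n, hn⟩ := hedvd
  obtain ⟨Q, hQ⟩ : ∃ Q, R = Q + e := ⟨R - e, by omega⟩
  have hηz : dist (f^[R] z) z ≤ δ := by simpa using (hηf _ _ hRz 0 (by omega)).le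
  have hCz : PPath f δ z (orb f z R) z := ppath_orb' _ _ _ _ _ (by omega) hηz
  have hCw : PPath f δ w (orb f w R) w := by
    apply ppath_orb' _ _ _ _ _ (by omega)
    have := (hηf _ _ hRz (l * q) le_rfl).le
    rwa [← Function.iterate_add_apply, add_comm, Function.iterate_add_apply, ← hw] at this
  have hZW : PPath f δ z (orb f z (l * q)) w := hw ▸ ppath_orb f δ hδ.le z (l * q)
  have hWZ : PPath f δ w (orb f w (R - l * q)) z := by
    apply ppath_orb' _ _ _ _ _ (by omega)
    rwa [hw, ← Function.iterate_add_apply, show R - l * q + l * q = R by omega]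
  obtain ⟨Sh, hSh, hShl⟩ : ∃ Sh, PPath f δ z Sh z ∧ Sh.length = Q := by
    refine ⟨orb f z (a + 1) ++ orb f (f^[b + 1] z) (R - (b + 1)), ?_, ?_⟩
    · refine PPath.append (y := f^[b + 1] z) ?_ ?_
      · apply ppath_orb' _ _ _ _ _ (by omega)
        rwa [← Function.iterate_add_apply, show R - (b + 1) + (b + 1) = R by omega]
      · exact ppath_orb' _ _ _ _ _ (by omega) (hcell _ _ hcab).le
    · simp only [List.length_append, length_orb]; omega
  have hnR : n * R = n * Q + l * q := by rw [hQ, hn]; ring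
  refine ⟨z, n * R, fun M => ⟨rep n (orb f z R) ++ (rep M (orb f z R) ++ (rep n Sh ++ orb f z R)),
    (rep n Sh ++ orb f z (l * q)) ++ (rep M (orb f w R) ++
      (orb f w (R - l * q) ++ rep n (orb f z R))), ?_, ?_, ?_, ?_, ?_⟩⟩
  · exact PPath.append (PPath.append (PPath.append hCz (hSh.rep n)) (hCz.rep M)) (hCz.rep n)
  · exact PPath.append (PPath.append (PPath.append (hCz.rep n) hWZ) (hCw.rep M))
      (PPath.append hZW (hSh.rep n))
  · simp only [List.length_append, length_rep, length_orb, hShl]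
    omega
  · simp only [List.length_append, length_rep, length_orb, hShl]
    have : M ≤ M * R := Nat.le_mul_of_pos_right _ (by omega)
    omega
  · intro i hi hiM
    have hMR : M ≤ M * R := Nat.le_mul_of_pos_right _ (by omega)
    have e1 : (rep n (orb f z R)).length = n * R := by simp only [length_rep, length_orb]
    have e2 : (rep n Sh ++ orb f z (l * q)).length = n * R := by
      simp only [List.length_append, length_rep, length_orb, hShl]; omega
    have g1 : (rep n (orb f z R) ++ (rep M (orb f z R) ++ (rep n Sh ++ orb f z R))).getD i z =
        (rep M (orb f z R)).getD (i - n * R) z := by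
      rw [List.getD_append_right _ _ _ _ (by omega), e1,
        List.getD_append _ _ _ _ (by simp only [length_rep, length_orb]; omega)]
    have g2 : ((rep n Sh ++ orb f z (l * q)) ++ (rep M (orb f w R) ++
        (orb f w (R - l * q) ++ rep n (orb f z R)))).getD i z =
        (rep M (orb f w R)).getD (i - n * R) z := by
      rw [List.getD_append_right _ _ _ _ (by omega), e2,
        List.getD_append _ _ _ _ (by simp only [length_rep, length_orb]; omega)]
    rw [g1, g2]
    exact forall2_getD (R := fun a b => r ≤ dist a b)
      (forall2_rep (forall2_orb f (fun a b => r ≤ dist a b) z w R hsep) M) z _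
      (by simp only [length_rep, length_orb]; omega)

lemma limsup_eq_one (u : ℕ → ℝ) (h0 : ∀ n, 0 ≤ u n) (h1 : ∀ n, u n ≤ 1)
    (h : ∀ η > 0, ∃ᶠ n in atTop, 1 - η ≤ u n) : limsup u atTop = 1 := by
  have hb : IsBoundedUnder (· ≤ ·) atTop u := isBoundedUnder_of ⟨1, h1⟩
  have hc : IsCoboundedUnder (· ≤ ·) atTop u :=
    (isBoundedUnder_of ⟨0, h0⟩ : IsBoundedUnder (· ≥ ·) atTop u).isCoboundedUnder_le
  apply le_antisymm
  · exact limsup_le_of_le hc (Eventually.of_forall h1)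
  · apply le_of_forall_pos_le_add
    intro η hη
    have := le_limsup_of_frequently_le (h η hη) hb
    linarith

/-- Density criterion: blocks of good times `[A, A + m)` with `A` negligible. -/
lemma limsup_density (p : ℕ → Prop)
    (h : ∀ k N : ℕ, ∃ A T : ℕ, N ≤ T ∧ 0 < T ∧ k * A ≤ T ∧ ∀ i, A ≤ i → i < T → p i) :
    limsup (fun n : ℕ => (((Finset.range n).filter fun i => p i).card : ℝ) / n) atTop = 1 := by
  apply limsup_eq_one
  · intro n; positivity
  · intro n
    apply div_le_one_of_le₀ _ (by positivity)
    exact_mod_cast (Finset.card_filter_le _ _).trans (by simp)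
  · intro η hη
    obtain ⟨k, hk⟩ := exists_nat_gt (1 / η)
    have hk0 : (0 : ℝ) < k := lt_trans (by positivity) hk
    rw [frequently_atTop]
    intro N
    obtain ⟨A, T, hN, hT, hA, hp⟩ := h k N
    refine ⟨T, hN, ?_⟩
    have hsub : Finset.Ico A T ⊆ (Finset.range T).filter fun i => p i := by
      intro i hi
      simp only [Finset.mem_Ico, Finset.mem_filter, Finset.mem_range] at hi ⊢
      exact ⟨hi.2, hp i hi.1 hi.2⟩
    have hc := Finset.card_le_card hsub
    rw [Nat.card_Ico] at hc
    have hc' : (T : ℝ) ≤ ((Finset.range T).filter fun i => p i).card + A := by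
      exact_mod_cast (by omega : T ≤ ((Finset.range T).filter fun i => p i).card + A)
    have hT' : (0 : ℝ) < T := by exact_mod_cast hT
    have hA' : (k : ℝ) * A ≤ T := by exact_mod_cast hA
    rw [le_div_iff₀ hT']
    have h3 : (A : ℝ) ≤ η * T := by
      have h4 : 1 ≤ η * k := by rw [div_lt_iff₀ hη] at hk; linarith
      have h5 : (A : ℝ) ≤ η * k * A := le_mul_of_one_le_left (by positivity) h4
      have h6 : η * (k * A) ≤ η * T := mul_le_mul_of_nonneg_left hA' hη.le
      linarith
    linarith

lemma not_dc1_self (f : X → X) (x : X) : ¬ DC1Pair f x x := by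
  rintro ⟨-, δ, hδ, h⟩
  have : (fun n : ℕ => (((Finset.range n).filter fun i =>
      dist (f^[i] x) (f^[i] x) > δ).card : ℝ) / n) = fun _ => 0 := by
    funext n
    have : ((Finset.range n).filter fun i => dist (f^[i] x) (f^[i] x) > δ) = ∅ := by
      apply Finset.filter_false_of_mem
      intro i _
      simp [hδ.le]
    rw [this]; simp
  rw [this, limsup_const] at h
  norm_num at h

/-- Prepend the symbol `false`. -/
def bitAt (s : ℕ → Bool) : ℕ → Bool
  | 0 => false
  | m + 1 => s m

end Helpers

/-- Theorem 1.2: limit shadowing and positive topological entropy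
imply distributional chaos of type 1. -/
theorem limitShadowing_posEntropy_DC1 {X : Type*} [MetricSpace X] [CompactSpace X]
    (f : X → X) (hf : Continuous f) (h1 : LimitShadowing f)
    (h2 : 0 < Dynamics.coverEntropy f Set.univ) :
    ExhibitsDC1 f := by
  obtain ⟨r, hr, hgood⟩ := exists_good hf h1 h2
  choose z₀ t₀ U₀ V₀ hU₀ hV₀ hlen₀ hM₀ hsep₀ using
    fun n : ℕ => hgood (1 / ((n : ℝ) + 1)) (by positivity)
  obtain ⟨a, ψ, hψ, hlim⟩ := CompactSpace.tendsto_subseq z₀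
  have hη : Tendsto (fun n => 1 / ((ψ n : ℝ) + 1) + dist (z₀ (ψ n)) (z₀ (ψ (n + 1)))) atTop
      (nhds 0) := by
    have e1 : Tendsto (fun n => 1 / ((ψ n : ℝ) + 1)) atTop (nhds 0) :=
      (tendsto_one_div_add_atTop_nhds_zero_nat (𝕜 := ℝ)).comp hψ.tendsto_atTop
    have e2 : Tendsto (fun n => dist (z₀ (ψ n)) (z₀ (ψ (n + 1)))) atTop (nhds (dist a a)) :=
      hlim.dist (hlim.comp (tendsto_add_atTop_nat 1))
    simpa using e1.add e2
  let MM : ℕ → ℕ → ℕ := fun n s => (n + 1) * (s + t₀ (ψ n)) + n + 1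
  let S : ℕ → ℕ := fun n => Nat.rec 0 (fun n s => s + (U₀ (ψ n) (MM n s)).length) n
  let M : ℕ → ℕ := fun n => MM n (S n)
  have hS : ∀ n, S (n + 1) = S n + (U₀ (ψ n) (M n)).length := fun n => rfl
  have hM : ∀ n, M n = (n + 1) * (S n + t₀ (ψ n)) + n + 1 := fun n => rfl
  have hS0 : S 0 = 0 := rfl
  clear_value M S
  let LL : (ℕ → Bool) → ℕ → List X := fun s n =>
    if bitAt s (Nat.unpair n).1 then V₀ (ψ n) (M n) else U₀ (ψ n) (M n)
  have hLlen : ∀ s n, (LL s n).length = (U₀ (ψ n) (M n)).length := fun s n => by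
    simp only [LL]; split_ifs
    · exact hlen₀ _ _
    · rfl
  have hLP : ∀ s n, PPath f (1 / ((ψ n : ℝ) + 1)) (z₀ (ψ n)) (LL s n) (z₀ (ψ n)) := fun s n => by
    simp only [LL]; split_ifs
    · exact hV₀ _ _
    · exact hU₀ _ _
  have hLM : ∀ s n, M n < (LL s n).length := fun s n => by rw [hLlen]; exact hM₀ _ _
  have htrack : ∀ s, ∃ p : X, ∀ ε > 0, ∃ N, ∀ n ≥ N, ∀ j < (LL s n).length, ∀ d,
      dist (f^[S n + j] p) ((LL s n).getD j d) < ε := fun s =>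
    limit_track h1 (fun n => z₀ (ψ n)) (LL s) _ hη (fun n => by have := hLM s n; omega)
      (fun n => (hLP s n).change_end le_rfl
        (List.ne_nil_of_length_pos (by have := hLM s n; omega))) S hS0
      (fun n => by rw [hLlen]; exact hS n)
  choose p hp using htrack
  have hkM : ∀ k n, k ≤ n → k * (S n + t₀ (ψ n)) ≤ M n := fun k n hk => by
    have : k * (S n + t₀ (ψ n)) ≤ (n + 1) * (S n + t₀ (ψ n)) :=
      Nat.mul_le_mul_right _ (by omega)
    rw [hM]; omega
  have hnM : ∀ n, n < M n := fun n => by rw [hM]; omega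
  have hdc : ∀ s t, s ≠ t → DC1Pair f (p s) (p t) := by
    intro s t hst
    refine ⟨fun δ hδ => ?_, r / 2, half_pos hr, ?_⟩
    · apply limsup_density
      intro k N
      obtain ⟨N₁, hN₁⟩ := hp s (δ / 2) (half_pos hδ)
      obtain ⟨N₂, hN₂⟩ := hp t (δ / 2) (half_pos hδ)
      obtain ⟨n, hn, hn0⟩ : ∃ n, k + N + N₁ + N₂ ≤ n ∧ (Nat.unpair n).1 = 0 :=
        ⟨Nat.pair 0 (k + N + N₁ + N₂), Nat.right_le_pair _ _, by simp⟩
      have e3 := hkM k n (by omega)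
      have e4 := hnM n
      have e5 : k * S n ≤ k * (S n + t₀ (ψ n)) := Nat.mul_le_mul_left _ (by omega)
      refine ⟨S n, S n + M n, by omega, by omega, by omega, fun i hi hi' => ?_⟩
      obtain ⟨j, rfl⟩ : ∃ j, i = S n + j := ⟨i - S n, by omega⟩
      have hj := hLM s n
      have hj' := hLM t n
      have e1 := hN₁ n (by omega) j (by omega) (p s)
      have e2 := hN₂ n (by omega) j (by omega) (p s)
      have hLL : LL s n = LL t n := by simp [LL, hn0, bitAt]
      rw [← hLL] at e2
      have := dist_triangle_right (f^[S n + j] (p s)) (f^[S n + j] (p t)) ((LL s n).getD j (p s))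
      linarith
    · apply limsup_density
      intro k N
      obtain ⟨m, hm⟩ := Function.ne_iff.1 hst
      obtain ⟨N₁, hN₁⟩ := hp s (r / 8) (by positivity)
      obtain ⟨N₂, hN₂⟩ := hp t (r / 8) (by positivity)
      obtain ⟨n, hn, hn0⟩ : ∃ n, k + N + N₁ + N₂ ≤ n ∧ (Nat.unpair n).1 = m + 1 :=
        ⟨Nat.pair (m + 1) (k + N + N₁ + N₂), Nat.right_le_pair _ _, by simp⟩
      have e3 := hkM k n (by omega)
      have e4 := hnM n
      refine ⟨S n + t₀ (ψ n), S n + M n, by omega, by omega, by omega, fun i hi hi' => ?_⟩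
      obtain ⟨j, rfl⟩ : ∃ j, i = S n + j := ⟨i - S n, by omega⟩
      have hj := hLM s n
      have hj' := hLM t n
      have e1 := hN₁ n (by omega) j (by omega) (z₀ (ψ n))
      have e2 := hN₂ n (by omega) j (by omega) (z₀ (ψ n))
      have hfar : r ≤ dist ((LL s n).getD j (z₀ (ψ n))) ((LL t n).getD j (z₀ (ψ n))) := by
        have e6 := hsep₀ (ψ n) (M n) j (by omega) (by omega)
        have e7 := e6
        rw [dist_comm] at e7
        simp only [LL, hn0, bitAt]
        cases hs : s m <;> cases ht : t m <;> simp only [hs, ht, ne_eq, not_true_eq_false] at hm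
        · simpa using e6
        · simpa using e7
      have := dist_triangle4 ((LL s n).getD j (z₀ (ψ n))) (f^[S n + j] (p s))
        (f^[S n + j] (p t)) ((LL t n).getD j (z₀ (ψ n)))
      rw [dist_comm _ (f^[S n + j] (p s))] at this
      change r / 2 < dist (f^[S n + j] (p s)) (f^[S n + j] (p t))
      linarith
  have hinj : Function.Injective p := by
    intro s t hpst
    by_contra hst
    have := hdc s t hst
    rw [hpst] at this
    exact not_dc1_self f _ this
  refine ⟨range p, fun hc => ?_, ?_⟩
  · have h3 : Countable (ℕ → Bool) := by
      have : (univ : Set (ℕ → Bool)).Countable :=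
        Set.countable_of_injective_of_countable_image hinj.injOn (by rwa [image_univ])
      exact Set.countable_univ_iff.1 this
    have h4 : Countable (Set ℕ) := by
      refine Function.Injective.countable (f := fun A : Set ℕ => fun n => decide (n ∈ A)) ?_
      intro A B h
      ext n
      simpa using congrFun h n
    obtain ⟨g, hg⟩ := h4.exists_injective_nat
    exact Function.cantor_injective g hg
  · rintro _ ⟨s, rfl⟩ _ ⟨t, rfl⟩ hst
    exact hdc s t fun h => hst (by rw [h])
end
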